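/- arXiv:2004.09092 — 2 statements merged into one kernel-verified Lean document; each statement's English description precedes it below -/
import Mathlib

section
/- If α is a quadratic irrational whose continued fraction expansion is [a_0; a_1, ..., a_r, overline{a_{r+1}, ..., a_{r+s}}] (ultimately periodic with period a_{r+1}, ..., a_{r+s}), then α has a Lévy constant and L(α) = (1/s) · log( (t + √(t² − (−1)^s · 4)) / 2 ), where t = T(a_{r+1}, ..., a_{r+s}) is the trace of the matrix product [[a_{r+1},1],[1,0]]···[[a_{r+s},1],[1,0]]. -/
open Filter Real Matrix

noncomputable section

/-- `contQ w n` is the denominator `Q n` of the `n`-th convergent of the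
continued fraction `[0; w 1, w 2, …]`. -/
def contQ (w : ℕ → ℕ) : ℕ → ℕ
  | 0 => 1
  | 1 => w 1
  | n + 2 => w (n + 2) * contQ w (n + 1) + contQ w n

/-- The real number `[0; w 1, w 2, …]` has Lévy constant `ℓ`, i.e. the sequence
`(log Q n)/n` converges to `ℓ`. -/
def HasLevyConstant (w : ℕ → ℕ) (ℓ : ℝ) : Prop :=
  Tendsto (fun n : ℕ => Real.log (contQ w n) / n) atTop (nhds ℓ)

/-- `L` is a (finite) factor of the infinite word `w = w 1 w 2 ⋯`. -/
def IsFactorSeq (w : ℕ → ℕ) (L : List ℕ) : Prop :=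
  ∃ i : ℕ, L = (List.range L.length).map fun j => w (i + j + 1)

/-- The complexity function `p(n, w)`: the number of distinct factors of length `n`. -/
def complexity (w : ℕ → ℕ) (n : ℕ) : ℕ :=
  Set.ncard {L : List ℕ | L.length = n ∧ IsFactorSeq w L}

/-- The mechanical word `s_{θ,ρ}` over `{a,b}` (floor version), indexed from `1`. -/
def mechWord (a b : ℕ) (θ ρ : ℝ) (n : ℕ) : ℕ :=
  if ⌊(n : ℝ) * θ + ρ⌋ - ⌊((n : ℝ) - 1) * θ + ρ⌋ = 0 then a else b

/-- The mechanical word `s'_{θ,ρ}` over `{a,b}` (ceiling version), indexed from `1`. -/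
def mechWord' (a b : ℕ) (θ ρ : ℝ) (n : ℕ) : ℕ :=
  if ⌈(n : ℝ) * θ + ρ⌉ - ⌈((n : ℝ) - 1) * θ + ρ⌉ = 0 then a else b

/-- `w` is a Sturmian word over `{a, b}`: a mechanical word with irrational slope. -/
def IsSturmianWord (a b : ℕ) (w : ℕ → ℕ) : Prop :=
  ∃ θ ρ : ℝ, Irrational θ ∧ θ ∈ Set.Icc (0 : ℝ) 1 ∧ ρ ∈ Set.Ico (0 : ℝ) 1 ∧
    (w = mechWord a b θ ρ ∨ w = mechWord' a b θ ρ)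

/-- The matrix `[[x, 1], [1, 0]]`. -/
def cfMat (x : ℝ) : Matrix (Fin 2) (Fin 2) ℝ := !![x, 1; 1, 0]

/-- `T(b₁, …, b_n)`: the trace of `[[b₁,1],[1,0]] ⋯ [[b_n,1],[1,0]]` for a word
`b₁ ⋯ b_n` over the positive integers.  The trace of the empty word is `2`. -/
def traceWord (L : List ℕ) : ℝ := ((L.map fun c => cfMat (c : ℝ)).prod).trace

/-- The polynomial `𝐓_n(x) = Tr([[x,1],[1,0]]^n)`. -/
def Tpoly (n : ℕ) (x : ℝ) : ℝ := ((cfMat x) ^ n).trace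

/-- The lower Christoffel word `w_{p/q}` over `{a, b}`: the prefix of length `q`
of the mechanical word `s_{p/q, 0}`. -/
def christoffel (a b p q : ℕ) : List ℕ :=
  (List.range q).map fun n => mechWord a b ((p : ℝ) / (q : ℝ)) 0 (n + 1)

/-- `T(w_{p/q})`, the trace attached to the lower Christoffel word of slope `p/q`. -/
def Tw (a b p q : ℕ) : ℝ := traceWord (christoffel a b p q)

/-- The continuant `K(b₁, …, b_n)`: the denominator of `[0; b₁, …, b_n]`. -/
def contList : List ℕ → ℕ
  | [] => 1
  | [x] => x
  | x :: y :: t => x * contList (y :: t) + contList t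

/-- The standard words attached to `d₁, d₂, …` : `sturmM a b d (k+1)` is the word
`M_k`, where `M_{-1} = b`, `M_0 = a` and `M_k = M_{k-1}^{d_k} M_{k-2}`. -/
def sturmM (a b : ℕ) (d : ℕ → ℕ) : ℕ → List ℕ
  | 0 => [b]
  | 1 => [a]
  | k + 2 => (List.replicate (d (k + 1)) (sturmM a b d (k + 1))).flatten ++ sturmM a b d k

/-- Denominators `q_k` of the convergents of `θ = [0; 1 + d₁, d₂, d₃, …]`. -/
def cfQ (d : ℕ → ℕ) : ℕ → ℕ
  | 0 => 1
  | 1 => 1 + d 1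
  | k + 2 => d (k + 2) * cfQ d (k + 1) + cfQ d k

/-- Numerators `p_k` of the convergents of `θ = [0; 1 + d₁, d₂, d₃, …]`. -/
def cfP (d : ℕ → ℕ) : ℕ → ℕ
  | 0 => 0
  | 1 => 1
  | k + 2 => d (k + 2) * cfP d (k + 1) + cfP d k

/-- `w` is ultimately periodic (so that `[0; w 1, w 2, …]` is a quadratic irrational). -/
def UltimatelyPeriodic (w : ℕ → ℕ) : Prop :=
  ∃ r s : ℕ, 0 < s ∧ ∀ n, r < n → w (n + s) = w n

end

/-- The row vector `(Q n, Q (n - 1))`, with the convention `Q (-1) = 0`. -/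
def contQRow (w : ℕ → ℕ) : ℕ → Fin 2 → ℝ
  | 0 => ![1, 0]
  | n + 1 => ![(contQ w (n + 1) : ℝ), (contQ w n : ℝ)]

/-- The product `[[w (n+1), 1], [1, 0]] ⋯ [[w (n+k), 1], [1, 0]]`. -/
def cfProd (w : ℕ → ℕ) (n k : ℕ) : Matrix (Fin 2) (Fin 2) ℝ :=
  ((List.range k).map fun i => cfMat (w (n + 1 + i) : ℝ)).prod

theorem cfProd_succ (w : ℕ → ℕ) (n k : ℕ) :
    cfProd w n (k + 1) = cfProd w n k * cfMat (w (n + 1 + k) : ℝ) := by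
  simp [cfProd, List.range_succ]

theorem contQRow_succ (w : ℕ → ℕ) (n : ℕ) :
    contQRow w (n + 1) = contQRow w n ᵥ* cfMat (w (n + 1) : ℝ) := by
  cases n with
  | zero =>
    ext i
    fin_cases i <;> simp [contQRow, cfMat, contQ, Matrix.vecMul, dotProduct]
  | succ n =>
    ext i
    fin_cases i <;> simp [contQRow, cfMat, contQ, Matrix.vecMul, dotProduct, mul_comm]

theorem contQRow_add (w : ℕ → ℕ) (n k : ℕ) :
    contQRow w (n + k) = contQRow w n ᵥ* cfProd w n k := by
  induction k with
  | zero => simp [cfProd]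
  | succ k ih =>
    rw [← add_assoc, contQRow_succ, ih, cfProd_succ, Matrix.vecMul_vecMul]
    congr 4
    ring_nf

theorem det_cfProd (w : ℕ → ℕ) (n k : ℕ) : (cfProd w n k).det = (-1) ^ k := by
  induction k with
  | zero => simp [cfProd]
  | succ k ih =>
    rw [cfProd_succ, Matrix.det_mul, ih, pow_succ]
    simp [cfMat, Matrix.det_fin_two]

theorem cfProd_entries_pos (w : ℕ → ℕ) (hw : ∀ n, 1 ≤ n → 0 < w n) (n k : ℕ) :
    0 < cfProd w n (k + 1) 0 0 ∧ 0 < cfProd w n (k + 1) 0 1 ∧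
      0 < cfProd w n (k + 1) 1 0 ∧ 0 ≤ cfProd w n (k + 1) 1 1 := by
  induction k with
  | zero =>
    have h : (0 : ℝ) < w (n + 1) := by exact_mod_cast hw _ (by omega)
    simpa [cfProd, cfMat] using h
  | succ k ih =>
    obtain ⟨h00, h01, h10, h11⟩ := ih
    have h : (0 : ℝ) < w (n + 1 + (k + 1)) := by exact_mod_cast hw _ (by omega)
    rw [cfProd_succ]
    simp only [cfMat, Matrix.mul_apply, Fin.sum_univ_two, Matrix.of_apply, Matrix.cons_val',
      Matrix.cons_val_zero, Matrix.cons_val_one, Matrix.cons_val_fin_one, mul_one, mul_zero,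
      add_zero]
    refine ⟨?_, ?_, ?_, ?_⟩ <;> positivity

theorem contQ_pos_and_le_succ (w : ℕ → ℕ) (hw : ∀ n, 1 ≤ n → 0 < w n) (n : ℕ) :
    0 < contQ w n ∧ contQ w n ≤ contQ w (n + 1) := by
  induction n with
  | zero => exact ⟨Nat.one_pos, hw 1 le_rfl⟩
  | succ n ih =>
    refine ⟨ih.1.trans_le ih.2, ?_⟩
    have h : contQ w (n + 2) = w (n + 2) * contQ w (n + 1) + contQ w n := rfl
    have h2 := Nat.le_mul_of_pos_left (contQ w (n + 1)) (hw (n + 2) (by omega))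
    change _ ≤ contQ w (n + 2)
    omega

theorem contQ_pos (w : ℕ → ℕ) (hw : ∀ n, 1 ≤ n → 0 < w n) (n : ℕ) : 0 < contQ w n :=
  (contQ_pos_and_le_succ w hw n).1

theorem contQ_mono (w : ℕ → ℕ) (hw : ∀ n, 1 ≤ n → 0 < w n) : Monotone (contQ w) :=
  monotone_nat_of_le_succ fun n => (contQ_pos_and_le_succ w hw n).2

theorem contQRow_zero (w : ℕ → ℕ) (n : ℕ) : contQRow w n 0 = contQ w n := by
  cases n <;> simp [contQRow, contQ]

theorem contQRow_one_mem (w : ℕ → ℕ) (hw : ∀ n, 1 ≤ n → 0 < w n) (n : ℕ) :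
    0 ≤ contQRow w n 1 ∧ contQRow w n 1 ≤ contQ w n := by
  cases n with
  | zero => simp [contQRow]
  | succ n =>
    have h := (contQ_pos_and_le_succ w hw n).2
    simp [contQRow, h]

/-- The larger eigenvalue of a real `2 × 2` matrix with positive off-diagonal entries and
nonnegative lower right entry is positive and has a positive eigenvector. -/
theorem exists_pos_eigenvector (P : Matrix (Fin 2) (Fin 2) ℝ) (h01 : 0 < P 0 1)
    (h10 : 0 < P 1 0) (h11 : 0 ≤ P 1 1) :
    0 < (P.trace + √(P.trace ^ 2 - P.det * 4)) / 2 ∧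
      ∃ u : Fin 2 → ℝ, 0 < u 0 ∧ 0 < u 1 ∧
        P *ᵥ u = ((P.trace + √(P.trace ^ 2 - P.det * 4)) / 2) • u := by
  set S := √(P.trace ^ 2 - P.det * 4) with hS
  have hbc := mul_pos h01 h10
  have hdisc : P.trace ^ 2 - P.det * 4 = (P 0 0 - P 1 1) ^ 2 + 4 * (P 0 1 * P 1 0) := by
    rw [Matrix.trace_fin_two, Matrix.det_fin_two]
    ring
  have hSsq : S ^ 2 = (P 0 0 - P 1 1) ^ 2 + 4 * (P 0 1 * P 1 0) := by
    rw [hS, Real.sq_sqrt (by rw [hdisc]; positivity), hdisc]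
  have hlt : |P 0 0 - P 1 1| < S := by
    refine abs_lt_of_sq_lt_sq ?_ (Real.sqrt_nonneg _)
    linarith
  have hgt : P 1 1 < (P.trace + S) / 2 := by
    rw [Matrix.trace_fin_two]
    linarith [(abs_lt.mp hlt).1]
  refine ⟨h11.trans_lt hgt, ![(P.trace + S) / 2 - P 1 1, P 1 0], by simpa using hgt,
    by simpa using h10, ?_⟩
  rw [Matrix.trace_fin_two]
  ext i
  fin_cases i
  · simp [Matrix.mulVec, dotProduct]
    linear_combination -(1 / 4) * hSsq
  · simp [Matrix.mulVec, dotProduct]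
    ring

theorem tendsto_div_of_abs_sub_mul_le {f : ℕ → ℝ} {c K : ℝ} (N : ℕ)
    (h : ∀ n, N ≤ n → |f n - n * c| ≤ K) :
    Tendsto (fun n : ℕ => f n / n) atTop (nhds c) := by
  rw [tendsto_iff_norm_sub_tendsto_zero]
  refine squeeze_zero' (Eventually.of_forall fun _ => norm_nonneg _) ?_
    (tendsto_const_div_atTop_nhds_zero_nat K)
  filter_upwards [eventually_ge_atTop N, eventually_gt_atTop 0] with n hn hn0
  have hn0' : (0 : ℝ) < n := by exact_mod_cast hn0
  have : f n / n - c = (f n - n * c) / n := by field_simp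
  rw [this, Real.norm_eq_abs, abs_div, abs_of_pos hn0']
  gcongr
  exact h n hn

theorem cfProd_periodic (w : ℕ → ℕ) (r s : ℕ) (hper : ∀ n, r < n → w (n + s) = w n) (k : ℕ) :
    cfProd w (r + k * s) s = cfProd w r s := by
  have h : ∀ k i, w (r + k * s + 1 + i) = w (r + 1 + i) := by
    intro k i
    induction k with
    | zero => simp
    | succ k ih =>
      rw [← ih, ← hper (r + k * s + 1 + i) (by omega)]
      ring_nf
  simp [cfProd, h]

theorem contQRow_dotProduct_eigenvector (w : ℕ → ℕ) (r s : ℕ)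
    (hper : ∀ n, r < n → w (n + s) = w n) (l : ℝ) (u : Fin 2 → ℝ)
    (hu : cfProd w r s *ᵥ u = l • u) (k : ℕ) :
    contQRow w (r + k * s) ⬝ᵥ u = l ^ k * (contQRow w r ⬝ᵥ u) := by
  induction k with
  | zero => simp
  | succ k ih =>
    rw [show r + (k + 1) * s = r + k * s + s by ring, contQRow_add, cfProd_periodic w r s hper,
      ← Matrix.dotProduct_mulVec, hu, dotProduct_smul, ih, smul_eq_mul, pow_succ]
    ring

theorem log_contQ_periodic_bounds (w : ℕ → ℕ) (hw : ∀ n, 1 ≤ n → 0 < w n) (r s : ℕ)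
    (hper : ∀ n, r < n → w (n + s) = w n) (l : ℝ) (hl : 0 < l) (u : Fin 2 → ℝ)
    (hu0 : 0 < u 0) (hu1 : 0 < u 1) (hu : cfProd w r s *ᵥ u = l • u) :
    ∃ c C : ℝ, ∀ k : ℕ, k * Real.log l + c ≤ Real.log (contQ w (r + k * s)) ∧
      Real.log (contQ w (r + k * s)) ≤ k * Real.log l + C := by
  have hlow : ∀ n, (contQ w n : ℝ) * u 0 ≤ contQRow w n ⬝ᵥ u := by
    intro n
    simp only [dotProduct, Fin.sum_univ_two, contQRow_zero]
    have := mul_nonneg (contQRow_one_mem w hw n).1 hu1.le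
    linarith
  have hupp : ∀ n, contQRow w n ⬝ᵥ u ≤ (contQ w n : ℝ) * (u 0 + u 1) := by
    intro n
    simp only [dotProduct, Fin.sum_univ_two, contQRow_zero]
    have := mul_le_mul_of_nonneg_right (contQRow_one_mem w hw n).2 hu1.le
    linarith
  have hQ : ∀ n, (0 : ℝ) < contQ w n := fun n => by exact_mod_cast contQ_pos w hw n
  have hN : 0 < contQRow w r ⬝ᵥ u := (mul_pos (hQ r) hu0).trans_le (hlow r)
  refine ⟨Real.log (contQRow w r ⬝ᵥ u) - Real.log (u 0 + u 1),
    Real.log (contQRow w r ⬝ᵥ u) - Real.log (u 0), fun k => ?_⟩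
  have h1 := hlow (r + k * s)
  have h2 := hupp (r + k * s)
  rw [contQRow_dotProduct_eigenvector w r s hper l u hu] at h1 h2
  have hQk := hQ (r + k * s)
  have h1' := Real.log_le_log (by positivity) h1
  have h2' := Real.log_le_log (by positivity) h2
  rw [Real.log_mul (by positivity) (by positivity), Real.log_mul (by positivity) (by positivity),
    Real.log_pow] at h1' h2'
  constructor <;> linarith

/-- Jager–Liardet. If `α` is the quadratic irrational with continued
fraction expansion `[a₀; a₁, …, a_r, \overline{a_{r+1}, …, a_{r+s}}]`, then `α` has
Lévy constant `(1/s) · log((t + √(t² - (-1)^s·4))/2)`, where `t` is the trace of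
`[[a_{r+1},1],[1,0]] ⋯ [[a_{r+s},1],[1,0]]`. -/
theorem stmt7 (a : ℕ → ℕ) (hpos : ∀ n, 1 ≤ n → 0 < a n)
    (r s : ℕ) (hs : 0 < s) (hper : ∀ n, r < n → a (n + s) = a n)
    (t : ℝ) (ht : t = (((List.range s).map fun i => cfMat (a (r + 1 + i) : ℝ)).prod).trace) :
    HasLevyConstant a
      (1 / (s : ℝ) * Real.log ((t + Real.sqrt (t ^ 2 - (-1 : ℝ) ^ s * 4)) / 2)) := by
  obtain ⟨m, rfl⟩ : ∃ m, s = m + 1 := ⟨s - 1, by omega⟩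
  obtain ⟨-, h01, h10, h11⟩ := cfProd_entries_pos a hpos r m
  obtain ⟨hl, u, hu0, hu1, hu⟩ := exists_pos_eigenvector (cfProd a r (m + 1)) h01 h10 h11
  rw [det_cfProd, show (cfProd a r (m + 1)).trace = t from ht.symm] at hl hu
  generalize hs' : m + 1 = s at *
  obtain ⟨c, C, hb⟩ := log_contQ_periodic_bounds a hpos r s hper _ hl u hu0 hu1 hu
  generalize Real.log ((t + √(t ^ 2 - (-1 : ℝ) ^ s * 4)) / 2) = L at hb ⊢
  have hsR : (0 : ℝ) < s := by exact_mod_cast hs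
  refine tendsto_div_of_abs_sub_mul_le (K := |c| + |C| + |L| + (r + s) / s * |L|) r
    fun n hn => ?_
  obtain ⟨k, j, hj, rfl⟩ : ∃ k j, j < s ∧ n = r + k * s + j :=
    ⟨(n - r) / s, (n - r) % s, Nat.mod_lt _ hs, by
      have := Nat.div_add_mod' (n - r) s
      omega⟩
  have hQ : ∀ i, (0 : ℝ) < contQ a i := fun i => by exact_mod_cast contQ_pos a hpos i
  have hlow : Real.log (contQ a (r + k * s)) ≤ Real.log (contQ a (r + k * s + j)) :=
    Real.log_le_log (hQ _) (by exact_mod_cast contQ_mono a hpos (by omega))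
  have hupp : Real.log (contQ a (r + k * s + j)) ≤ Real.log (contQ a (r + (k + 1) * s)) :=
    Real.log_le_log (hQ _) (by
      exact_mod_cast contQ_mono a hpos (by rw [add_mul, one_mul]; omega))
  have hk := (hb k).1
  have hk' := (hb (k + 1)).2
  have hdiff : ((r + k * s + j : ℕ) : ℝ) * (1 / s * L) = k * L + (r + j) / s * L := by
    push_cast
    field_simp
    ring
  have habs : |((r : ℝ) + j) / s * L| ≤ (r + s) / s * |L| := by
    rw [abs_mul, abs_of_nonneg (by positivity)]
    gcongr
  rw [hdiff]
  push_cast at hk'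
  obtain ⟨hd1, hd2⟩ := abs_le.mp habs
  rw [abs_le]
  constructor <;>
    linarith [neg_abs_le c, le_abs_self C, le_abs_self L, abs_nonneg c, abs_nonneg C, abs_nonneg L]
end

section
/- Let p/q and p'/q' be rationals in [0,1] with |pq' − p'q| = 1 and q > q'. Then the following four identities hold: (1) (T_{q+q'}(x_{p/q}) − T_{q+q'}(x_{(p+p')/(q+q')})) / (T_{q'}(x_{p/q}) − T_{q'}(x_{p'/q'})) = T_q(x_{p/q}) + (−1)^{q'} · (T_{q−q'}(x_{(p−p')/(q−q')}) − T_{q−q'}(x_{p/q})) / (T_{q'}(x_{p/q}) − T_{q'}(x_{p'/q'})); (2) (T_{q+q'}(x_{p'/q'}) − T_{q+q'}(x_{(p+p')/(q+q')})) / (T_q(x_{p'/q'}) − T_q(x_{p/q})) = T_{q'}(x_{p'/q'}) − (−1)^{q'} · (T_{q−q'}(x_{p'/q'}) − T_{q−q'}(x_{(p−p')/(q−q')})) / (T_q(x_{p'/q'}) − T_q(x_{p/q})); (3) (T_{q'}(x_{p'/q'}) − T_{q'}(x_{(p+p')/(q+q')})) / (T_q(x_{(p+p')/(q+q')}) − T_q(x_{p/q}))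 = T_{q'}(x_{(p+p')/(q+q')}) / T_q(x_{p/q}) − (−1)^{q'} · (T_{q−q'}(x_{(p+p')/(q+q')}) − T_{q−q'}(x_{(p−p')/(q−q')})) / ((T_q(x_{(p+p')/(q+q')}) − T_q(x_{p/q})) · T_q(x_{p/q})); (4) (T_q(x_{(p+p')/(q+q')}) − T_q(x_{p/q})) / (T_{q'}(x_{p'/q'}) − T_{q'}(x_{(p+p')/(q+q')})) = T_q(x_{(p+p')/(q+q')}) / T_{q'}(x_{p'/q'}) + (−1)^{q'} · (T_{q−q'}(x_{(p+p')/(q+q')}) − T_{q−q'}(x_{(p−p')/(q−q')})) / ((T_{q'}(x_{p'/q'}) − T_{q'}(x_{(p+p')/(q+q')})) · T_{q'}(x_{p'/q'})). -/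
open Filter Real Matrix

/-- The product of the matrices attached to the letters of the Christoffel word. -/
noncomputable def christoffelMat (a b p q : ℕ) : Matrix (Fin 2) (Fin 2) ℝ :=
  ((christoffel a b p q).map fun c : ℕ => cfMat (c : ℝ)).prod

theorem Tw_eq_trace (a b p q : ℕ) : Tw a b p q = (christoffelMat a b p q).trace := by
  unfold Tw traceWord christoffelMat
  congr 2
  simp [List.bind_eq_flatMap, ← List.map_eq_flatMap]

theorem floor_natCast_mul_div (n p q : ℕ) :
    ⌊(n : ℝ) * ((p : ℝ) / (q : ℝ)) + 0⌋ = ((n * p / q : ℕ) : ℤ) := by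
  have h : (n : ℝ) * ((p : ℝ) / (q : ℝ)) + 0 = ((n * p : ℕ) : ℝ) / (q : ℝ) := by
    push_cast; ring
  rw [h, ← Nat.floor_div_eq_div (K := ℝ) (n * p) q, Int.natCast_floor_eq_floor (by positivity)]

theorem mechWord_div (a b p q n : ℕ) :
    mechWord a b ((p : ℝ) / (q : ℝ)) 0 (n + 1) =
      if (n + 1) * p / q = n * p / q then a else b := by
  unfold mechWord
  have h : (((n + 1 : ℕ) : ℝ) - 1) = (n : ℝ) := by push_cast; ring
  rw [h, floor_natCast_mul_div, floor_natCast_mul_div]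
  simp only [sub_eq_zero, Nat.cast_inj]

theorem mul_mediant_div_of_le {p q p' q' : ℕ} (hq : 1 ≤ q) (hq' : 1 ≤ q')
    (h : p' * q = p * q' + 1) {n : ℕ} (hn : n ≤ q) :
    n * (p + p') / (q + q') = n * p / q := by
  obtain ⟨m, hm⟩ : ∃ m, m = n * p / q := ⟨_, rfl⟩
  have h1 : m * q ≤ n * p := hm ▸ Nat.div_mul_le_self _ _
  have h2 : n * p < (m + 1) * q := by
    rw [hm, mul_comm _ q]; exact Nat.lt_mul_div_succ _ hq
  rw [← hm]
  zify at *
  have hY : ((n : ℤ) * p' - m * q') * q = n + (n * p - m * q) * q' := by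
    linear_combination (n : ℤ) * h
  have hY0 : (0 : ℤ) ≤ (n : ℤ) * p' - m * q' := by
    by_contra hc
    nlinarith [mul_nonneg (sub_nonneg.2 h1) (by omega : (0 : ℤ) ≤ q')]
  have hY1 : (n : ℤ) * p' - m * q' ≤ q' := by
    by_contra hc
    have hX : (n : ℤ) * p - m * q ≤ q - 1 := by nlinarith
    nlinarith [mul_le_mul_of_nonneg_right hX (by omega : (0 : ℤ) ≤ q')]
  have key : n * (p + p') / (q + q') = m := by
    apply Nat.div_eq_of_lt_le
    · zify; nlinarith
    · zify; nlinarith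
  exact_mod_cast key

theorem add_mul_mediant_div_of_le {p q p' q' : ℕ} (hq : 1 ≤ q) (hq' : 1 ≤ q')
    (h : p' * q = p * q' + 1) {n : ℕ} (hn : n ≤ q') :
    (q + n) * (p + p') / (q + q') = p + n * p' / q' := by
  obtain ⟨m, hm⟩ : ∃ m, m = n * p' / q' := ⟨_, rfl⟩
  have h1 : m * q' ≤ n * p' := hm ▸ Nat.div_mul_le_self _ _
  have h2 : n * p' < (m + 1) * q' := by
    rw [hm, mul_comm _ q']; exact Nat.lt_mul_div_succ _ hq'
  rw [← hm]
  zify at *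
  have hX : ((m : ℤ) * q - n * p) * q' = n - (n * p' - m * q') * q := by
    linear_combination (n : ℤ) * h
  have hX1 : (m : ℤ) * q - n * p ≤ 1 := by
    by_contra hc
    nlinarith [mul_nonneg (sub_nonneg.2 h1) (by omega : (0 : ℤ) ≤ q)]
  have hX0 : 1 - (q : ℤ) ≤ (m : ℤ) * q - n * p := by
    by_contra hc
    have hY : (n : ℤ) * p' - m * q' ≤ q' - 1 := by nlinarith
    nlinarith [mul_le_mul_of_nonneg_right hY (by omega : (0 : ℤ) ≤ q)]
  have key : (q + n) * (p + p') / (q + q') = p + m := by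
    apply Nat.div_eq_of_lt_le
    · zify; nlinarith
    · zify; nlinarith
  exact_mod_cast key

/-- The Christoffel word of a mediant is the concatenation of those of its Farey parents. -/
theorem christoffel_mediant (a b : ℕ) {p q p' q' : ℕ} (hq : 1 ≤ q) (hq' : 1 ≤ q')
    (h : p' * q = p * q' + 1) :
    christoffel a b (p + p') (q + q') = christoffel a b p q ++ christoffel a b p' q' := by
  unfold christoffel
  rw [List.range_add, List.map_append, List.map_map]
  congr 1
  · refine List.map_congr_left fun n hn => ?_
    have hn : n < q := List.mem_range.1 hn
    rw [mechWord_div, mechWord_div, mul_mediant_div_of_le hq hq' h (by omega),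
      mul_mediant_div_of_le hq hq' h (by omega)]
  · refine List.map_congr_left fun n hn => ?_
    have hn : n < q' := List.mem_range.1 hn
    simp only [Function.comp_apply]
    rw [mechWord_div, mechWord_div, add_assoc q n 1,
      add_mul_mediant_div_of_le hq hq' h (by omega),
      add_mul_mediant_div_of_le hq hq' h (by omega)]
    simp

theorem christoffelMat_mediant (a b : ℕ) {p q p' q' : ℕ} (hq : 1 ≤ q) (hq' : 1 ≤ q')
    (h : p' * q = p * q' + 1) :
    christoffelMat a b (p + p') (q + q') = christoffelMat a b p q * christoffelMat a b p' q' := by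
  simp [christoffelMat, christoffel_mediant a b hq hq' h]

theorem det_cfMat (x : ℝ) : (cfMat x).det = -1 := by
  simp [cfMat, Matrix.det_fin_two]

theorem det_prod_cfMat (L : List ℕ) :
    ((L.map fun c : ℕ => cfMat (c : ℝ)).prod).det = (-1) ^ L.length := by
  induction L with
  | nil => simp
  | cons c L ih =>
    simp only [List.map_cons, List.prod_cons, Matrix.det_mul, ih, det_cfMat, List.length_cons]
    ring

theorem det_christoffelMat (a b p q : ℕ) : (christoffelMat a b p q).det = (-1) ^ q := by
  rw [christoffelMat, det_prod_cfMat]; simp [christoffel]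

theorem christoffelMat_zero_one (a b : ℕ) : christoffelMat a b 0 1 = cfMat a := by
  have h := mechWord_div a b 0 1 0
  norm_num at h
  simp [christoffelMat, christoffel, h]

theorem christoffelMat_one_one (a b : ℕ) : christoffelMat a b 1 1 = cfMat b := by
  have h := mechWord_div a b 1 1 0
  norm_num at h
  simp [christoffelMat, christoffel, h]

theorem trace_mul_mul_self (A B : Matrix (Fin 2) (Fin 2) ℝ) :
    (A * B * B).trace = (A * B).trace * B.trace - B.det * A.trace := by
  simp [Matrix.trace_fin_two, Matrix.det_fin_two, Matrix.mul_apply, Fin.sum_univ_two]; ring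

theorem four_mul_det_commutator (A B : Matrix (Fin 2) (Fin 2) ℝ) :
    4 * (A * B - B * A).det =
      (A.trace ^ 2 - 4 * A.det) * (B.trace ^ 2 - 4 * B.det)
        - (2 * (A * B).trace - A.trace * B.trace) ^ 2 := by
  simp [Matrix.trace_fin_two, Matrix.det_fin_two, Matrix.mul_apply, Fin.sum_univ_two]; ring

theorem Tpoly_add {m n : ℕ} (h : n ≤ m) (x : ℝ) :
    Tpoly (m + n) x = Tpoly m x * Tpoly n x - (-1) ^ n * Tpoly (m - n) x := by
  have := trace_mul_mul_self (cfMat x ^ (m - n)) (cfMat x ^ n)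
  rw [← pow_add, ← pow_add, Nat.sub_add_cancel h, Matrix.det_pow, det_cfMat] at this
  exact this

theorem farey_num_le {p q p' q' : ℕ} (hq' : 1 ≤ q') (hqq' : q' < q)
    (h : p' * q = p * q' + 1 ∨ p * q' = p' * q + 1) : p' ≤ p := by
  by_contra hc
  push Not at hc
  rcases h with h | h
  · nlinarith [Nat.mul_le_mul hc hqq', Nat.mul_le_mul (Nat.succ_le_of_lt hc) (le_refl q)]
  · nlinarith [Nat.mul_le_mul hc.le hqq'.le]

theorem Tw_mediant (a b : ℕ) {p q p' q' : ℕ} (hq' : 1 ≤ q') (hqq' : q' < q)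
    (h : p' * q = p * q' + 1 ∨ p * q' = p' * q + 1) :
    Tw a b (p + p') (q + q') =
      Tw a b p q * Tw a b p' q' - (-1) ^ q' * Tw a b (p - p') (q - q') := by
  have hpp := farey_num_le hq' hqq' h
  obtain ⟨r, rfl⟩ := Nat.exists_eq_add_of_le hpp
  obtain ⟨s, rfl⟩ := Nat.exists_eq_add_of_le hqq'.le
  have hs : 1 ≤ s := by omega
  simp only [Tw_eq_trace, Nat.add_sub_cancel_left]
  rw [← det_christoffelMat a b p' q']
  rcases h with h | h
  · rw [christoffelMat_mediant a b (by omega) hq' h, add_comm p', add_comm q',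
      christoffelMat_mediant a b hs hq' (by nlinarith), trace_mul_mul_self]
  · rw [add_comm (p' + r), add_comm (q' + s),
      christoffelMat_mediant a b hq' (by omega) h,
      christoffelMat_mediant a b hq' hs (by nlinarith), Matrix.trace_mul_comm,
      Matrix.trace_mul_comm (christoffelMat a b p' q') (christoffelMat a b r s),
      ← trace_mul_mul_self, mul_assoc, Matrix.trace_mul_comm, mul_assoc,
      Matrix.trace_mul_comm (christoffelMat a b r s)]

theorem det_commutator_christoffelMat (a b : ℕ) (N : ℕ) :
    ∀ {p q p' q' : ℕ}, q + q' ≤ N → 1 ≤ q → 1 ≤ q' → p ≤ q → p' ≤ q' →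
      p' * q = p * q' + 1 →
      (christoffelMat a b p q * christoffelMat a b p' q' -
        christoffelMat a b p' q' * christoffelMat a b p q).det =
          (-1) ^ (q + q') * ((a : ℝ) - b) ^ 2 := by
  induction N with
  | zero => intro p q p' q' hN hq hq'; omega
  | succ N ih =>
    intro p q p' q' hN hq hq' hp hp' h
    rcases lt_trichotomy q q' with hlt | heq | hlt
    · have hpp := farey_num_le hq hlt (Or.inr h)
      obtain ⟨r, rfl⟩ := Nat.exists_eq_add_of_le hpp
      obtain ⟨s, rfl⟩ := Nat.exists_eq_add_of_le hlt.le
      have hrs : r * q = p * s + 1 := by nlinarith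
      have hr : r ≤ s := by nlinarith
      have := ih (by omega) hq (by omega) hp hr hrs
      rw [christoffelMat_mediant a b hq (by omega) hrs]
      set A := christoffelMat a b p q with hA
      set C := christoffelMat a b r s
      have e : A * (A * C) - A * C * A = A * (A * C - C * A) := by noncomm_ring
      rw [e, Matrix.det_mul, this, hA, det_christoffelMat]
      ring
    · subst heq
      have hq1 : q = 1 := by
        have : q ∣ 1 := (Nat.dvd_add_right (dvd_mul_left q p)).1 (h ▸ dvd_mul_left q p')
        exact Nat.dvd_one.1 this
      subst hq1
      obtain rfl : p = 0 := by omega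
      obtain rfl : p' = 1 := by omega
      rw [christoffelMat_zero_one, christoffelMat_one_one]
      simp [cfMat, Matrix.det_fin_two]
      ring
    · have hpp := farey_num_le hq' hlt (Or.inl h)
      obtain ⟨r, rfl⟩ := Nat.exists_eq_add_of_le hpp
      obtain ⟨s, rfl⟩ := Nat.exists_eq_add_of_le hlt.le
      have hrs : p' * s = r * q' + 1 := by nlinarith
      have hr : r ≤ s := by nlinarith
      have := ih (by omega) (by omega) hq' hr hp' hrs
      rw [add_comm p', add_comm q', christoffelMat_mediant a b (by omega) hq' hrs]
      set B := christoffelMat a b p' q' with hB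
      set C := christoffelMat a b r s
      have e : C * B * B - B * (C * B) = (C * B - B * C) * B := by noncomm_ring
      rw [e, Matrix.det_mul, this, hB, det_christoffelMat]
      ring

theorem cfMat_pow_symm (x : ℝ) (n : ℕ) :
    (cfMat x ^ n) 1 0 = (cfMat x ^ n) 0 1 ∧
      (cfMat x ^ n) 0 0 = (cfMat x ^ n) 1 1 + x * (cfMat x ^ n) 0 1 := by
  induction n with
  | zero => simp
  | succ n ih =>
    obtain ⟨h1, h2⟩ := ih
    simp only [pow_succ, Matrix.mul_apply, Fin.sum_univ_two]
    simp [cfMat] at *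
    exact ⟨by linear_combination x * h1 - h2, by linear_combination -h1⟩

theorem cfMat_pow_pos {x : ℝ} (hx : 0 < x) (n : ℕ) :
    0 < (cfMat x ^ n) 0 0 ∧ 0 ≤ (cfMat x ^ n) 0 1 ∧ 0 ≤ (cfMat x ^ n) 1 1 := by
  induction n with
  | zero => simp
  | succ n ih =>
    obtain ⟨h1, h2, h3⟩ := ih
    have h4 := (cfMat_pow_symm x n).1
    simp only [pow_succ, Matrix.mul_apply, Fin.sum_univ_two]
    simp [cfMat] at *
    exact ⟨by positivity, h1.le, by linarith⟩

theorem cfMat_pow_apply_zero_one_pos {x : ℝ} (hx : 0 < x) {n : ℕ} (hn : 1 ≤ n) :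
    0 < (cfMat x ^ n) 0 1 := by
  obtain ⟨m, rfl⟩ := Nat.exists_eq_add_of_le' hn
  have h := (cfMat_pow_pos hx m).1
  simp only [pow_succ, Matrix.mul_apply, Fin.sum_univ_two]
  simpa [cfMat] using h

theorem Tpoly_pos {x : ℝ} (hx : 0 < x) (n : ℕ) : 0 < Tpoly n x := by
  obtain ⟨h1, -, h3⟩ := cfMat_pow_pos hx n
  simp only [Tpoly, Matrix.trace_fin_two]
  linarith

theorem Tpoly_sq_sub (x : ℝ) (n : ℕ) :
    Tpoly n x ^ 2 - 4 * (-1) ^ n = (x ^ 2 + 4) * (cfMat x ^ n) 0 1 ^ 2 := by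
  obtain ⟨h1, h2⟩ := cfMat_pow_symm x n
  have hd : (cfMat x ^ n).det = (-1) ^ n := by rw [Matrix.det_pow, det_cfMat]
  rw [Matrix.det_fin_two, h1, h2] at hd
  rw [← hd, Tpoly, Matrix.trace_fin_two, h2]
  ring

theorem pow_eq_intCast_smul_add {P : Matrix (Fin 2) (Fin 2) ℝ} {t e : ℤ}
    (ht : P.trace = t) (he : P.det = e) (k : ℕ) :
    ∃ z w : ℤ, P ^ k = (z : ℝ) • P + (w : ℝ) • (1 : Matrix (Fin 2) (Fin 2) ℝ) := by
  induction k with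
  | zero => exact ⟨0, 1, by simp⟩
  | succ k ih =>
    obtain ⟨z, w, h⟩ := ih
    have hsq : P * P = (t : ℝ) • P - (e : ℝ) • (1 : Matrix (Fin 2) (Fin 2) ℝ) := by
      rw [← ht, ← he]
      ext i j
      fin_cases i <;> fin_cases j <;>
        simp [Matrix.mul_apply, Fin.sum_univ_two, Matrix.trace_fin_two, Matrix.det_fin_two] <;>
        ring
    refine ⟨z * t + w, -(z * e), ?_⟩
    rw [pow_succ, h, add_mul, smul_mul_assoc, hsq, smul_mul_assoc, one_mul]
    push_cast
    module

theorem prod_cfMat_eq_map (L : List ℕ) :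
    ∃ N : Matrix (Fin 2) (Fin 2) ℤ,
      (L.map fun c : ℕ => cfMat (c : ℝ)).prod = N.map (Int.castRingHom ℝ) := by
  induction L with
  | nil => exact ⟨1, by simp⟩
  | cons c L ih =>
    obtain ⟨N, hN⟩ := ih
    refine ⟨!![(c : ℤ), 1; 1, 0] * N, ?_⟩
    rw [List.map_cons, List.prod_cons, hN, Matrix.map_mul]
    congr 1
    ext i j
    fin_cases i <;> fin_cases j <;> simp [cfMat]

theorem exists_int_eq_Tw (a b p q : ℕ) : ∃ z : ℤ, Tw a b p q = z := by
  obtain ⟨N, hN⟩ := prod_cfMat_eq_map (christoffel a b p q)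
  exact ⟨N.trace, by
    rw [Tw_eq_trace, christoffelMat, hN]; simp [Matrix.trace_fin_two]⟩

theorem prod_cfMat_bounds {L : List ℕ} (hL : ∀ c ∈ L, 1 ≤ c) :
    1 ≤ (L.map fun c : ℕ => cfMat (c : ℝ)).prod 0 0 ∧
    0 ≤ (L.map fun c : ℕ => cfMat (c : ℝ)).prod 0 1 ∧
    0 ≤ (L.map fun c : ℕ => cfMat (c : ℝ)).prod 1 0 ∧
    0 ≤ (L.map fun c : ℕ => cfMat (c : ℝ)).prod 1 1 ∧
    1 ≤ (L.map fun c : ℕ => cfMat (c : ℝ)).prod 1 0 +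
      (L.map fun c : ℕ => cfMat (c : ℝ)).prod 1 1 := by
  induction L with
  | nil => simp
  | cons c L ih =>
    obtain ⟨h1, h2, h3, h4, h5⟩ := ih fun d hd => hL d (List.mem_cons_of_mem _ hd)
    have hc : (1 : ℝ) ≤ c := by exact_mod_cast hL c List.mem_cons_self
    rw [List.map_cons, List.prod_cons]
    generalize (L.map fun c : ℕ => cfMat (c : ℝ)).prod = N at *
    simp only [Matrix.mul_apply, Fin.sum_univ_two]
    simp [cfMat]
    refine ⟨by nlinarith, by positivity, by linarith, h2, by linarith⟩

theorem le_Tw {a b p q : ℕ} (ha : 0 < a) (hb : 0 < b) (hp : 0 < p) (hpq : p < q) :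
    (a : ℝ) * b + 2 ≤ Tw a b p q := by
  obtain ⟨k, rfl⟩ : ∃ k, q = k + 2 := ⟨q - 2, by omega⟩
  set f : ℕ → ℕ := fun n => mechWord a b ((p : ℝ) / ((k + 2 : ℕ) : ℝ)) 0 (n + 1) with hf
  have hfirst : f 0 = a := by
    rw [hf]; simp only []
    rw [mechWord_div, if_pos]
    simp [Nat.div_eq_of_lt hpq]
  have hlast : f (k + 1) = b := by
    rw [hf]; simp only []
    rw [mechWord_div, if_neg]
    refine ne_of_gt ?_
    have : (k + 1 + 1) * p / (k + 2) = p := Nat.mul_div_cancel_left p (by omega)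
    rw [this, Nat.div_lt_iff_lt_mul (by omega)]
    nlinarith
  have hword : christoffel a b p (k + 2) =
      a :: ((List.range k).map fun n => f (n + 1)) ++ [b] := by
    have : christoffel a b p (k + 2) = (List.range (k + 2)).map f := rfl
    rw [this, List.range_succ, List.map_append, List.map_singleton, hlast,
      List.range_succ_eq_map, List.map_cons, hfirst, List.map_map]
    rfl
  have hpos : ∀ c ∈ (List.range k).map fun n => f (n + 1), 1 ≤ c := by
    intro c hc
    obtain ⟨n, -, rfl⟩ := List.mem_map.1 hc
    simp only [hf, mechWord]
    split_ifs <;> omega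
  have ha' : (1 : ℝ) ≤ a := by exact_mod_cast ha
  have hb' : (1 : ℝ) ≤ b := by exact_mod_cast hb
  obtain ⟨h1, h2, h3, h4, h5⟩ := prod_cfMat_bounds hpos
  rw [Tw_eq_trace, christoffelMat, hword]
  simp only [List.cons_append, List.map_cons, List.map_append, List.prod_cons, List.prod_append,
    List.map_nil, List.prod_nil, mul_one]
  generalize (((List.range k).map fun n => f (n + 1)).map fun c : ℕ => cfMat (c : ℝ)).prod = N
    at *
  simp only [Matrix.trace_fin_two, Matrix.mul_apply, Fin.sum_univ_two]
  simp [cfMat]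
  nlinarith [mul_nonneg h3 (sub_nonneg.2 hb'), mul_nonneg h2 (sub_nonneg.2 ha'),
    mul_nonneg (sub_nonneg.2 h1) (by positivity : (0 : ℝ) ≤ a * b)]

theorem christoffelMat_one_succ (a b k : ℕ) :
    christoffelMat a b 1 (k + 1) = cfMat a ^ k * cfMat b := by
  induction k with
  | zero => simp [christoffelMat_one_one]
  | succ k ih =>
    have := christoffelMat_mediant a b (p := 0) (q := 1) (p' := 1) (q' := k + 1)
      le_rfl (by omega) (by omega)
    rw [zero_add, add_comm 1 (k + 1), ih, christoffelMat_zero_one] at this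
    rw [this, pow_succ', mul_assoc]

theorem christoffelMat_self_succ (a b k : ℕ) :
    christoffelMat a b k (k + 1) = cfMat a * cfMat b ^ k := by
  induction k with
  | zero => simp [christoffelMat_zero_one]
  | succ k ih =>
    have := christoffelMat_mediant a b (p := k) (q := k + 1) (p' := 1) (q' := 1)
      (by omega) le_rfl (by omega)
    rw [ih, christoffelMat_one_one] at this
    rw [this, pow_succ, mul_assoc]

theorem Tpoly_one (x : ℝ) : Tpoly 1 x = x := by
  simp [Tpoly, cfMat, Matrix.trace_fin_two]

theorem trace_pow_mul_cfMat_ne {x y : ℝ} (hx : 0 < x) (hxy : x ≠ y) (k : ℕ) :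
    (cfMat x ^ k * cfMat y).trace ≠ Tpoly (k + 1) x := by
  intro h
  have h0 := (cfMat_pow_pos hx k).1
  rw [Tpoly, pow_succ] at h
  generalize cfMat x ^ k = N at *
  simp only [Matrix.trace_fin_two, Matrix.mul_apply, Fin.sum_univ_two] at h
  simp [cfMat] at h
  rcases h with h | h
  · exact hxy h.symm
  · exact h0.ne' h

theorem exists_int_eq_of_sq_of_mul {S : ℝ} {m z w : ℤ} (hsq : S ^ 2 = m) (hz : z ≠ 0)
    (hw : S * z = w) : ∃ s : ℤ, S = s := by
  have h : w ^ 2 = m * z ^ 2 := by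
    have : (w : ℝ) ^ 2 = m * (z : ℝ) ^ 2 := by rw [← hw, ← hsq]; ring
    exact_mod_cast this
  obtain ⟨c, rfl⟩ : z ∣ w := (Int.pow_dvd_pow_iff two_ne_zero).1 ⟨m, by rw [h]; ring⟩
  refine ⟨c, ?_⟩
  have hz' : (z : ℝ) ≠ 0 := by exact_mod_cast hz
  apply mul_right_cancel₀ hz'
  rw [hw]; push_cast; ring

theorem le_sq_add_one_of_sq_sub_sq {s n d : ℤ} (hd : d ≠ 0) (hs : 2 ≤ s)
    (h : s ^ 2 - n ^ 2 = 4 * d ^ 2 ∨ s ^ 2 - n ^ 2 = -(4 * d ^ 2)) : s ≤ d ^ 2 + 1 := by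
  wlog hn : 0 ≤ n generalizing n
  · exact this (n := -n) (by simpa using h) (by omega)
  have hd2 : 0 < d ^ 2 := by positivity
  have hpar : Even (s - n) := by
    have h1 : Even ((s - n) * (s + n)) := by
      rcases h with h | h
      · exact ⟨2 * d ^ 2, by linarith⟩
      · exact ⟨-(2 * d ^ 2), by linarith⟩
    rcases Int.even_mul.1 h1 with h2 | h2
    · exact h2
    · have : s - n = s + n - 2 * n := by ring
      rw [this]
      exact h2.sub (even_two_mul n)
  obtain ⟨k, hk⟩ := hpar
  rcases lt_trichotomy k 0 with hk0 | hk0 | hk0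
  · have : n = s - 2 * k := by linarith
    subst this
    rcases h with h | h <;> nlinarith
  · have : n = s := by linarith
    subst this
    rcases h with h | h <;> nlinarith
  · have : n = s - 2 * k := by linarith
    subst this
    rcases h with h | h <;> nlinarith

/-- Farey neighbours are attached to different values of `x`. -/
theorem not_Tpoly_eq_Tw_of_farey {a b : ℕ} (ha : 0 < a) (hb : 0 < b) (hab : a ≠ b)
    {p q p' q' : ℕ} (hq : 1 ≤ q) (hq' : 1 ≤ q') (hp : p ≤ q) (hp' : p' ≤ q')
    (h : p' * q = p * q' + 1) {x : ℝ} (hx : 0 < x)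
    (h1 : Tpoly q x = Tw a b p q) (h2 : Tpoly q' x = Tw a b p' q') : False := by
  have hab' : (a : ℝ) ≠ b := by exact_mod_cast hab
  rcases Nat.eq_zero_or_pos p with rfl | hp0
  · obtain ⟨rfl, rfl⟩ : p' = 1 ∧ q = 1 := by
      rw [zero_mul, zero_add] at h
      exact ⟨Nat.dvd_one.1 ⟨_, h.symm⟩, Nat.dvd_one.1 ⟨_, (mul_comm p' q ▸ h).symm⟩⟩
    obtain ⟨k, rfl⟩ := Nat.exists_eq_add_of_le' hq'
    rw [Tpoly_one, Tw_eq_trace, christoffelMat_zero_one, ← pow_one (cfMat (a : ℝ)),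
      ← Tpoly, Tpoly_one] at h1
    subst h1
    rw [Tw_eq_trace, christoffelMat_one_succ] at h2
    exact trace_pow_mul_cfMat_ne hx hab' k h2.symm
  rcases hp'.eq_or_lt with rfl | hpq'
  · have hdvd : p' ∣ 1 := (Nat.dvd_add_right (dvd_mul_left p' p)).1 (h ▸ dvd_mul_right p' q)
    obtain rfl := Nat.dvd_one.1 hdvd
    obtain rfl : q = p + 1 := by omega
    rw [Tpoly_one, Tw_eq_trace, christoffelMat_one_one, ← pow_one (cfMat (b : ℝ)),
      ← Tpoly, Tpoly_one] at h2
    subst h2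
    rw [Tw_eq_trace, christoffelMat_self_succ, Matrix.trace_mul_comm] at h1
    exact trace_pow_mul_cfMat_ne hx hab'.symm p h1.symm
  have hpq : p < q := by
    by_contra hc
    have := Nat.mul_le_mul (not_lt.1 hc) hpq'.le
    nlinarith
  have hp0' : 0 < p' := Nat.pos_of_ne_zero fun h0 => by simp [h0] at h
  have hb1 := le_Tw ha hb hp0 hpq
  have hb2 := le_Tw ha hb hp0' hpq'
  obtain ⟨t₁, ht₁⟩ := exists_int_eq_Tw a b p q
  obtain ⟨t₂, ht₂⟩ := exists_int_eq_Tw a b p' q'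
  obtain ⟨t₃, ht₃⟩ := exists_int_eq_Tw a b (p + p') (q + q')
  have hD1 := Tpoly_sq_sub x q
  have hD2 := Tpoly_sq_sub x q'
  have hu1 := cfMat_pow_apply_zero_one_pos hx hq
  have hu2 := cfMat_pow_apply_zero_one_pos hx hq'
  have hu3 := cfMat_pow_apply_zero_one_pos hx (Nat.mul_pos hq hq')
  obtain ⟨z₁, w₁, hz₁⟩ := pow_eq_intCast_smul_add (P := cfMat x ^ q) (t := t₁) (e := (-1) ^ q)
    (by rw [← ht₁, ← h1, Tpoly]) (by rw [Matrix.det_pow, det_cfMat]; push_cast; rfl) q'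
  obtain ⟨z₂, w₂, hz₂⟩ := pow_eq_intCast_smul_add (P := cfMat x ^ q') (t := t₂) (e := (-1) ^ q')
    (by rw [← ht₂, ← h2, Tpoly]) (by rw [Matrix.det_pow, det_cfMat]; push_cast; rfl) q
  have hv1 : (cfMat x ^ (q * q')) 0 1 = z₁ * (cfMat x ^ q) 0 1 := by
    rw [pow_mul, hz₁]; simp
  have hv2 : (cfMat x ^ (q * q')) 0 1 = z₂ * (cfMat x ^ q') 0 1 := by
    rw [mul_comm q, pow_mul, hz₂]; simp
  have hz₁0 : z₁ ≠ 0 := by rintro rfl; simp [hv1] at hu3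
  rw [h1, ht₁] at hD1
  rw [h2, ht₂] at hD2
  set u₁ := (cfMat x ^ q) 0 1
  set u₂ := (cfMat x ^ q') 0 1
  set S : ℝ := (x ^ 2 + 4) * u₁ * u₂ with hS
  have hS0 : 0 < S := by positivity
  have hSsq : S ^ 2 = ((t₁ : ℝ) ^ 2 - 4 * (-1) ^ q) * ((t₂ : ℝ) ^ 2 - 4 * (-1) ^ q') := by
    rw [hD1, hD2]; ring
  obtain ⟨s, hs⟩ : ∃ s : ℤ, S = s := by
    refine exists_int_eq_of_sq_of_mul (z := z₁)
      (m := (t₁ ^ 2 - 4 * (-1) ^ q) * (t₂ ^ 2 - 4 * (-1) ^ q'))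
      (w := (t₂ ^ 2 - 4 * (-1) ^ q') * z₂) ?_ hz₁0 ?_
    · rw [hSsq]; push_cast; ring
    · push_cast
      rw [hD2]
      calc S * z₁ = (x ^ 2 + 4) * u₂ * (z₁ * u₁) := by rw [hS]; ring
        _ = (x ^ 2 + 4) * u₂ * (z₂ * u₂) := by rw [← hv1, hv2]
        _ = _ := by ring
  have ha' : (1 : ℝ) ≤ a := by exact_mod_cast ha
  have hb' : (1 : ℝ) ≤ b := by exact_mod_cast hb
  have hg : ∀ (t : ℝ) (n : ℕ), (a : ℝ) * b + 2 ≤ t →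
      (a : ℝ) * b * (a * b + 4) ≤ t ^ 2 - 4 * (-1) ^ n := by
    intro t n ht
    have hsgn : ((-1 : ℝ)) ^ n ≤ 1 := by rcases neg_one_pow_eq_or ℝ n with e | e <;> norm_num [e]
    have hab0 : (0 : ℝ) ≤ a * b := by positivity
    nlinarith
  have hSge : (a : ℝ) * b * (a * b + 4) ≤ S := by
    refine (sq_le_sq₀ (by positivity) hS0.le).1 ?_
    rw [hSsq, sq]
    exact mul_le_mul (hg _ _ (ht₁ ▸ hb1)) (hg _ _ (ht₂ ▸ hb2)) (by positivity)
      (hD1 ▸ by positivity)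
  have hsge : (a : ℤ) * b * (a * b + 4) ≤ s := by
    rw [hs] at hSge; exact_mod_cast hSge
  have hF := four_mul_det_commutator (christoffelMat a b p q) (christoffelMat a b p' q')
  rw [det_commutator_christoffelMat a b (q + q') le_rfl hq hq' hp hp' h,
    det_christoffelMat, det_christoffelMat, ← christoffelMat_mediant a b hq hq' h,
    ← Tw_eq_trace, ← Tw_eq_trace, ← Tw_eq_trace, ht₁, ht₂, ht₃, ← hSsq, hs] at hF
  have hF' : s ^ 2 - (2 * t₃ - t₁ * t₂) ^ 2 = 4 * ((-1) ^ (q + q') * ((a : ℤ) - b) ^ 2) := by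
    exact_mod_cast hF.symm
  have ha'' : (1 : ℤ) ≤ a := by exact_mod_cast ha
  have hb'' : (1 : ℤ) ≤ b := by exact_mod_cast hb
  have hab1 : (1 : ℤ) ≤ a * b := by nlinarith
  have hle := le_sq_add_one_of_sq_sub_sq (s := s) (n := 2 * t₃ - t₁ * t₂) (d := (a : ℤ) - b)
    (sub_ne_zero.2 (by exact_mod_cast hab)) (by nlinarith) (by
      rcases neg_one_pow_eq_or ℤ (q + q') with e | e <;> rw [e] at hF'
      · left; linarith
      · right; linarith)
  nlinarith [mul_nonneg (by nlinarith : (0 : ℤ) ≤ (a : ℤ) ^ 2 - 1)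
    (by nlinarith : (0 : ℤ) ≤ (b : ℤ) ^ 2 - 1)]

/-- Lemma `lem:third`. For Farey neighbours `p/q`, `p'/q'` in `[0,1]`
with `q > q'`, writing `x₁ = x_{p/q}`, `x₂ = x_{p'/q'}`, `x₃ = x_{(p+p')/(q+q')}` and
`x₄ = x_{(p-p')/(q-q')}` (the unique positive reals with `𝐓_q(x_{p/q}) = T(w_{p/q})`,
etc.), the four identities (eqe), (eqo), (eqt), (equ) hold. -/
theorem stmt12 (a b : ℕ) (ha : 0 < a) (hb : 0 < b) (hab : a ≠ b)
    (p q p' q' : ℕ) (hq' : 1 ≤ q') (hqq' : q' < q) (hp : p ≤ q) (hp' : p' ≤ q')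
    (hdet : (p : ℤ) * q' - p' * q = 1 ∨ (p : ℤ) * q' - p' * q = -1)
    (x₁ x₂ x₃ x₄ : ℝ)
    (hx₁ : 0 < x₁) (hx₁T : Tpoly q x₁ = Tw a b p q)
    (hx₂ : 0 < x₂) (hx₂T : Tpoly q' x₂ = Tw a b p' q')
    (hx₃ : 0 < x₃) (hx₃T : Tpoly (q + q') x₃ = Tw a b (p + p') (q + q'))
    (hx₄ : 0 < x₄) (hx₄T : Tpoly (q - q') x₄ = Tw a b (p - p') (q - q')) :
    ((Tpoly (q + q') x₁ - Tpoly (q + q') x₃) / (Tpoly q' x₁ - Tpoly q' x₂)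
        = Tpoly q x₁ + (-1 : ℝ) ^ q' *
            ((Tpoly (q - q') x₄ - Tpoly (q - q') x₁) / (Tpoly q' x₁ - Tpoly q' x₂))) ∧
    ((Tpoly (q + q') x₂ - Tpoly (q + q') x₃) / (Tpoly q x₂ - Tpoly q x₁)
        = Tpoly q' x₂ - (-1 : ℝ) ^ q' *
            ((Tpoly (q - q') x₂ - Tpoly (q - q') x₄) / (Tpoly q x₂ - Tpoly q x₁))) ∧
    ((Tpoly q' x₂ - Tpoly q' x₃) / (Tpoly q x₃ - Tpoly q x₁)
        = Tpoly q' x₃ / Tpoly q x₁ - (-1 : ℝ) ^ q' *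
            ((Tpoly (q - q') x₃ - Tpoly (q - q') x₄) /
              ((Tpoly q x₃ - Tpoly q x₁) * Tpoly q x₁))) ∧
    ((Tpoly q x₃ - Tpoly q x₁) / (Tpoly q' x₂ - Tpoly q' x₃)
        = Tpoly q x₃ / Tpoly q' x₂ + (-1 : ℝ) ^ q' *
            ((Tpoly (q - q') x₃ - Tpoly (q - q') x₄) /
              ((Tpoly q' x₂ - Tpoly q' x₃) * Tpoly q' x₂))) := by
  have hdet' : p' * q = p * q' + 1 ∨ p * q' = p' * q + 1 := by
    rcases hdet with h | h
    · right; zify; linarith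
    · left; zify; linarith
  have hne₁₂ : ∀ x, 0 < x → Tpoly q x = Tw a b p q → Tpoly q' x ≠ Tw a b p' q' := by
    intro x hx h1 h2
    rcases hdet' with h | h
    · exact not_Tpoly_eq_Tw_of_farey ha hb hab (by omega) hq' hp hp' h hx h1 h2
    · exact not_Tpoly_eq_Tw_of_farey ha hb hab hq' (by omega) hp' hp h hx h2 h1
  have hne₁₃ : Tpoly q x₃ ≠ Tw a b p q := by
    intro h1
    rcases hdet' with h | h
    · exact not_Tpoly_eq_Tw_of_farey ha hb hab (by omega) (by omega) hp (by omega)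
        (by linarith) hx₃ h1 hx₃T
    · exact not_Tpoly_eq_Tw_of_farey ha hb hab (by omega) (by omega) (by omega) hp
        (by linarith) hx₃ hx₃T h1
  have hne₂₃ : Tpoly q' x₃ ≠ Tw a b p' q' := by
    intro h1
    rcases hdet' with h | h
    · exact not_Tpoly_eq_Tw_of_farey ha hb hab (by omega) (by omega) (by omega) hp'
        (by linarith) hx₃ hx₃T h1
    · exact not_Tpoly_eq_Tw_of_farey ha hb hab (by omega) (by omega) hp' (by omega)
        (by linarith) hx₃ h1 hx₃T
  have hmed := Tw_mediant a b hq' hqq' hdet'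
  rw [← hx₁T, ← hx₂T, ← hx₃T, ← hx₄T] at hmed
  have hadd := fun x => Tpoly_add hqq'.le x
  have hd₁ : Tpoly q' x₁ - Tpoly q' x₂ ≠ 0 :=
    sub_ne_zero.2 (hx₂T ▸ hne₁₂ x₁ hx₁ hx₁T)
  have hd₂ : Tpoly q x₂ - Tpoly q x₁ ≠ 0 :=
    sub_ne_zero.2 fun h => hne₁₂ x₂ hx₂ (h.trans hx₁T) hx₂T
  have hd₃ : Tpoly q x₃ - Tpoly q x₁ ≠ 0 := sub_ne_zero.2 (hx₁T ▸ hne₁₃)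
  have hd₄ : Tpoly q' x₂ - Tpoly q' x₃ ≠ 0 := sub_ne_zero.2 fun h => hne₂₃ (h.symm.trans hx₂T)
  have ht₁ : Tpoly q x₁ ≠ 0 := (Tpoly_pos hx₁ q).ne'
  have ht₂ : Tpoly q' x₂ ≠ 0 := (Tpoly_pos hx₂ q').ne'
  refine ⟨?_, ?_, ?_, ?_⟩
  · field_simp
    linear_combination hadd x₁ - hmed
  · field_simp
    linear_combination hadd x₂ - hmed
  · field_simp
    linear_combination hadd x₃ - hmed
  · field_simp
    linear_combination hmed - hadd x₃
end
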